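/- Let p be an odd prime, n a positive integer, q = p^n with q ≡ 3 (mod 4), and let F be a finite field with exactly q elements. Let Γ³ = {(ξ,τ,σ) ∈ F²×F×F : τσ = ξ·ξ} \ {0}. If a function f : Γ³ → ℂ attains equality in ∑_{η ∈ F⁴} | ∑_{(η₁,η₂) ∈ Γ³×Γ³, η₁+η₂=η} f(η₁)f(η₂) |² ≤ ((q⁵ − 2q⁴ + 2q³ − 3q + 3)/((q−1)(q²+1))) · ( ∑_{η ∈ Γ³} |f(η)|² )², then |f| is constant on Γ³. -/

import Mathlib

open Finset

section Geometry

variable {F : Type} [Field F]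

/-- The sum of two squares is anisotropic when `-1` is not a square. -/
lemma eq_zero_of_sq_add_sq_eq_zero (h : ¬ IsSquare (-1 : F)) {x y : F}
    (hxy : x ^ 2 + y ^ 2 = 0) : x = 0 ∧ y = 0 := by
  have hy : y = 0 := by
    by_contra hy
    exact h ⟨x / y, by field_simp; linear_combination -hxy⟩
  subst hy
  exact ⟨by simpa using hxy, rfl⟩

/-- The points of the affine circle of squared radius `c`. -/
def circlePoints (F : Type) [Field F] [Fintype F] [DecidableEq F] (c : F) : Finset (F × F) :=
  univ.filter fun w => w.1 ^ 2 + w.2 ^ 2 = c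

/-- The punctured cone `τσ = ξ·ξ` in `F⁴`. -/
def puncturedCone (F : Type) [Field F] [Fintype F] [DecidableEq F] : Finset (F × F × F × F) :=
  univ.filter fun v => v.2.2.1 * v.2.2.2 = v.1 ^ 2 + v.2.1 ^ 2 ∧ v ≠ 0

variable [Fintype F] [DecidableEq F]

lemma mem_circlePoints {c : F} {w : F × F} :
    w ∈ circlePoints F c ↔ w.1 ^ 2 + w.2 ^ 2 = c := by
  simp [circlePoints]

lemma mem_puncturedCone {v : F × F × F × F} :
    v ∈ puncturedCone F ↔ v.2.2.1 * v.2.2.2 = v.1 ^ 2 + v.2.1 ^ 2 ∧ v ≠ 0 := by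
  simp [puncturedCone]

lemma neg_mem_puncturedCone {v : F × F × F × F} (hv : v ∈ puncturedCone F) :
    -v ∈ puncturedCone F := by
  rw [mem_puncturedCone] at *
  simpa using hv

lemma smul_mem_puncturedCone (t : Fˣ) {v : F × F × F × F} (hv : v ∈ puncturedCone F) :
    t • v ∈ puncturedCone F := by
  rw [mem_puncturedCone] at *
  refine ⟨?_, (smul_ne_zero_iff_ne t).2 hv.2⟩
  simp only [Prod.smul_fst, Prod.smul_snd, Units.smul_def, smul_eq_mul]
  linear_combination (t : F) ^ 2 * hv.1

/-- Multiplication of Gaussian numbers carries circles to circles. -/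
lemma card_circlePoints_le_mul (h2 : ringChar F ≠ 2) (c : F) {k : F}
    (hk : k ≠ 0) : #(circlePoints F c) ≤ #(circlePoints F (k * c)) := by
  obtain ⟨a, b, hab⟩ : ∃ a b : F, a ^ 2 + b ^ 2 = k := by
    obtain ⟨a, b, hab⟩ := FiniteField.exists_root_sum_quadratic
      (f := (Polynomial.X ^ 2 : Polynomial F)) (g := Polynomial.X ^ 2 - Polynomial.C k)
      (by simp) (Polynomial.degree_X_pow_sub_C (by norm_num) k)
      (FiniteField.odd_card_of_char_ne_two h2)
    exact ⟨a, b, by simp at hab; linear_combination hab⟩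
  refine card_le_card_of_injOn (fun w => (a * w.1 - b * w.2, a * w.2 + b * w.1)) ?_ ?_
  · intro w hw
    simp only [SetLike.mem_coe, mem_circlePoints] at *
    rw [← hab, ← hw]; ring
  · rintro ⟨x, y⟩ - ⟨x', y'⟩ - hxy
    simp only [Prod.mk.injEq] at *
    obtain ⟨h1, h3⟩ := hxy
    constructor
    · apply mul_left_cancel₀ hk
      rw [← hab]; linear_combination a * h1 + b * h3
    · apply mul_left_cancel₀ hk
      rw [← hab]; linear_combination a * h3 - b * h1

lemma card_circlePoints (h : ¬ IsSquare (-1 : F)) (h2 : ringChar F ≠ 2) {c : F} (hc : c ≠ 0) :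
    #(circlePoints F c) = Fintype.card F + 1 := by
  have key : ∀ d ∈ (univ.erase 0 : Finset F), #(circlePoints F d) = #(circlePoints F c) := by
    intro d hd
    have hd : d ≠ 0 := by simpa using hd
    apply le_antisymm
    · simpa [hd] using card_circlePoints_le_mul h2 d (k := c / d) (by positivity)
    · simpa [hc] using card_circlePoints_le_mul h2 c (k := d / c) (by positivity)
  have total := card_eq_sum_card_fiberwise (s := (univ.erase 0 : Finset (F × F)))
    (t := (univ.erase 0 : Finset F)) (f := fun w => w.1 ^ 2 + w.2 ^ 2) (by
      rintro ⟨x, y⟩ hw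
      simp only [coe_erase, coe_univ, Set.mem_sdiff, Set.mem_univ, true_and,
        Set.mem_singleton_iff] at *
      intro h0
      obtain ⟨rfl, rfl⟩ := eq_zero_of_sq_add_sq_eq_zero h h0
      exact hw rfl)
  have fib : ∀ d ∈ (univ.erase 0 : Finset F),
      #{w ∈ (univ.erase 0 : Finset (F × F)) | w.1 ^ 2 + w.2 ^ 2 = d} = #(circlePoints F c) := by
    intro d hd
    rw [← key d hd]
    congr 1
    ext w
    simp only [mem_filter, mem_erase, mem_univ, and_true, mem_circlePoints,
      and_iff_right_iff_imp]
    rintro rfl rfl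
    simp at hd
  rw [sum_congr rfl fib] at total
  simp only [card_erase_of_mem (mem_univ _), card_univ, Fintype.card_prod, sum_const,
    smul_eq_mul] at total
  have hq : 1 < Fintype.card F := Fintype.one_lt_card
  obtain ⟨r, hr⟩ : ∃ r, Fintype.card F = r + 2 := ⟨_, (Nat.sub_add_cancel hq).symm⟩
  rw [hr] at total ⊢
  have : (r + 1) * #(circlePoints F c) = (r + 1) * (r + 2 + 1) := by
    have e : (r + 2) * (r + 2) - 1 = (r + 1) * (r + 2 + 1) := by
      rw [Nat.sub_eq_iff_eq_add (by nlinarith)]; ring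
    rw [← e, total]; rfl
  exact Nat.eq_of_mul_eq_mul_left (by omega) this

/-- Solutions `(τ, σ)` of `τσ = c` with `c ≠ 0`. -/
lemma card_filter_mul_eq {c : F} (hc : c ≠ 0) :
    #{w : F × F | w.1 * w.2 = c} = Fintype.card F - 1 := by
  rw [← Fintype.card_units, ← card_univ]
  symm
  refine card_bij (fun (u : Fˣ) _ => ((u : F), (u : F)⁻¹ * c)) ?_ ?_ ?_
  · intro u _; simp
  · intro u _ v _ huv
    exact Units.ext (Prod.ext_iff.1 huv).1
  · rintro ⟨x, y⟩ hw
    simp only [mem_filter, mem_univ, true_and] at hw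
    have hx : x ≠ 0 := by rintro rfl; simp at hw; exact hc hw.symm
    exact ⟨Units.mk0 x hx, mem_univ _, by simp [← hw, hx]⟩

/-- Solutions `(τ, σ) ≠ 0` of `τσ = 0`. -/
lemma card_filter_mul_eq_zero :
    #{w : F × F | w.1 * w.2 = 0 ∧ w ≠ 0} = 2 * (Fintype.card F - 1) := by
  have e : ({w : F × F | w.1 * w.2 = 0 ∧ w ≠ 0} : Finset (F × F)) =
      (univ.erase 0) ×ˢ {0} ∪ {0} ×ˢ (univ.erase 0) := by
    ext ⟨x, y⟩
    simp only [mem_filter, mem_univ, true_and, mem_union, mem_product, mem_erase, mem_singleton,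
      ne_eq, Prod.mk_eq_zero, mul_eq_zero, and_true]
    tauto
  rw [e, card_union_of_disjoint]
  · simp [card_erase_of_mem, two_mul]
  · rw [disjoint_left]
    rintro ⟨x, y⟩ hx hy
    simp only [mem_product, mem_erase, mem_singleton] at hx hy
    exact hx.1.1 hy.1

lemma card_puncturedCone (h : ¬ IsSquare (-1 : F)) :
    #(puncturedCone F) = (Fintype.card F - 1) * (Fintype.card F ^ 2 + 1) := by
  have total := card_eq_sum_card_fiberwise (s := puncturedCone F)
    (t := (univ : Finset (F × F))) (f := fun v => (v.1, v.2.1)) (by intro; simp)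
  have inj : ∀ a b : F, Function.Injective fun w : F × F => (a, b, w) := by
    intro a b u v huv; simpa using huv
  have fib : ∀ d : F × F, d ≠ 0 →
      #{v ∈ puncturedCone F | (v.1, v.2.1) = d} = Fintype.card F - 1 := by
    rintro ⟨a, b⟩ hd
    have hc : a ^ 2 + b ^ 2 ≠ 0 := fun h0 => hd (by
      obtain ⟨rfl, rfl⟩ := eq_zero_of_sq_add_sq_eq_zero h h0; rfl)
    rw [← card_filter_mul_eq hc, ← card_map ⟨_, inj a b⟩]
    congr 1
    ext ⟨x, y, t, s⟩
    simp only [mem_filter, mem_puncturedCone, mem_map, mem_univ, true_and,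
      Function.Embedding.coeFn_mk, Prod.mk.injEq, Prod.exists]
    constructor
    · rintro ⟨⟨h1, -⟩, rfl, rfl⟩
      exact ⟨t, s, h1, rfl, rfl, rfl, rfl⟩
    · rintro ⟨t, s, h1, rfl, rfl, rfl, rfl⟩
      refine ⟨⟨h1, ?_⟩, rfl, rfl⟩
      intro h0
      simp only [Prod.mk_eq_zero] at h0
      exact hd (by simp [h0.1, h0.2.1])
  have fib0 : #{v ∈ puncturedCone F | (v.1, v.2.1) = 0} = 2 * (Fintype.card F - 1) := by
    rw [← card_filter_mul_eq_zero, ← card_map ⟨_, inj 0 0⟩]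
    congr 1
    ext ⟨x, y, t, s⟩
    simp only [mem_filter, mem_puncturedCone, mem_map, mem_univ, true_and,
      Function.Embedding.coeFn_mk, Prod.mk.injEq, Prod.exists, Prod.mk_eq_zero, ne_eq]
    constructor
    · rintro ⟨⟨h1, h3⟩, rfl, rfl⟩
      exact ⟨t, s, ⟨by simpa using h1, by simpa using h3⟩, rfl, rfl, rfl, rfl⟩
    · rintro ⟨t, s, ⟨h1, h3⟩, rfl, rfl, rfl, rfl⟩
      exact ⟨⟨by simpa using h1, by simpa using h3⟩, rfl, rfl⟩
  rw [total, ← add_sum_erase _ _ (mem_univ 0), fib0,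
    sum_congr rfl fun d hd => fib d (ne_of_mem_erase hd), sum_const,
    card_erase_of_mem (mem_univ _), card_univ, Fintype.card_prod, smul_eq_mul]
  have hq : 1 < Fintype.card F := Fintype.one_lt_card
  obtain ⟨r, hr⟩ : ∃ r, Fintype.card F = r + 1 := ⟨_, (Nat.sub_add_cancel hq.le).symm⟩
  rw [hr]
  have e : (r + 1) * (r + 1) - 1 = r * r + 2 * r := by
    rw [Nat.sub_eq_iff_eq_add (by nlinarith)]; ring
  rw [e, Nat.add_sub_cancel]; ring

/-- The first members of pairs in the cone summing to `η`. -/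
def coneSection (η : F × F × F × F) : Finset (F × F × F × F) :=
  (puncturedCone F).filter fun a => η - a ∈ puncturedCone F

/-- Two isotropic vectors with isotropic sum are proportional. -/
lemma exists_eq_smul_of_add_isotropic (h : ¬ IsSquare (-1 : F))
    {a η : F × F × F × F} (ha : a ∈ puncturedCone F) (hη : η ∈ puncturedCone F)
    (hb : η - a ∈ puncturedCone F) : ∃ d : F, a = d • η := by
  obtain ⟨x, y, t, s⟩ := a
  obtain ⟨X, Y, T, S⟩ := η
  simp only [mem_puncturedCone, Prod.mk_sub_mk] at ha hη hb
  have orth : t * S + T * s = 2 * (x * X + y * Y) := by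
    linear_combination ha.1 + hη.1 - hb.1
  by_cases hT : T = 0
  · subst hT
    obtain ⟨rfl, rfl⟩ := eq_zero_of_sq_add_sq_eq_zero h
      (by linear_combination -hη.1 : X ^ 2 + Y ^ 2 = 0)
    have hS : S ≠ 0 := by
      rintro rfl; exact hη.2 rfl
    have ht : t = 0 := by
      have : t * S = 0 := by linear_combination orth
      simpa [hS] using this
    subst ht
    obtain ⟨rfl, rfl⟩ := eq_zero_of_sq_add_sq_eq_zero h
      (by linear_combination -ha.1 : x ^ 2 + y ^ 2 = 0)
    exact ⟨s / S, by simp [hS]⟩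
  · have e : (T * x - t * X) ^ 2 + (T * y - t * Y) ^ 2 = 0 := by
      linear_combination -T ^ 2 * ha.1 - t ^ 2 * hη.1 + t * T * orth
    obtain ⟨e1, e3⟩ := eq_zero_of_sq_add_sq_eq_zero h e
    have e4 : T * s = t * S := by
      apply mul_left_cancel₀ hT
      linear_combination T * orth + 2 * X * e1 + 2 * Y * e3 - 2 * t * hη.1
    refine ⟨t / T, ?_⟩
    simp only [Prod.smul_mk, smul_eq_mul, Prod.mk.injEq]
    refine ⟨?_, ?_, ?_, ?_⟩ <;> field_simp
    · linear_combination e1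
    · linear_combination e3
    · linear_combination e4

lemma card_coneSection_le_of_mem (h : ¬ IsSquare (-1 : F))
    {η : F × F × F × F} (hη : η ∈ puncturedCone F) :
    #(coneSection η) ≤ Fintype.card F - 2 := by
  have : coneSection η ⊆ ((univ.erase 0).erase 1 : Finset F).image fun d => d • η := by
    intro a ha
    obtain ⟨ha, hb⟩ := mem_filter.1 ha
    obtain ⟨d, rfl⟩ := exists_eq_smul_of_add_isotropic h ha hη hb
    refine mem_image.2 ⟨d, ?_, rfl⟩
    simp only [mem_erase, mem_univ, and_true]
    constructor
    · rintro rfl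
      simp [mem_puncturedCone] at hb
    · rintro rfl
      simp [mem_puncturedCone] at ha
  refine (card_le_card this).trans (card_image_le.trans ?_)
  rw [card_erase_of_mem (by simp), card_erase_of_mem (mem_univ _), card_univ]
  omega

lemma equations_of_mem_coneSection {X Y T S x y t s : F}
    (ha : (x, y, t, s) ∈ coneSection (X, Y, T, S)) : t * s = x ^ 2 + y ^ 2 ∧
      T * s + S * t - 2 * (X * x + Y * y) = T * S - X ^ 2 - Y ^ 2 := by
  simp only [coneSection, mem_filter, mem_puncturedCone, Prod.mk_sub_mk] at ha
  obtain ⟨⟨h1, -⟩, h3, -⟩ := ha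
  exact ⟨h1, by linear_combination h1 - h3⟩

lemma card_coneSection_le_of_ne_zero (h : ¬ IsSquare (-1 : F)) (hchar : ringChar F ≠ 2)
    {X Y T S : F} (hm : T * S - X ^ 2 - Y ^ 2 ≠ 0) (hT : T ≠ 0) :
    #(coneSection (X, Y, T, S)) ≤ Fintype.card F * (Fintype.card F - 1) := by
  set m := T * S - X ^ 2 - Y ^ 2 with hmdef
  rw [← card_filter_add_card_filter_not (fun a : F × F × F × F => a.2.2.1 = 0)]
  have c1 : #{a ∈ coneSection (X, Y, T, S) | a.2.2.1 = 0} ≤ 1 := by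
    rw [card_le_one_iff_subset_singleton]
    refine ⟨(0, 0, 0, m / T), ?_⟩
    rintro ⟨x, y, t, s⟩ ha
    obtain ⟨ha, rfl⟩ := mem_filter.1 ha
    obtain ⟨h1, h3⟩ := equations_of_mem_coneSection ha
    obtain ⟨rfl, rfl⟩ := eq_zero_of_sq_add_sq_eq_zero h
      (by linear_combination -h1 : x ^ 2 + y ^ 2 = 0)
    simp only [mem_singleton, Prod.mk.injEq, true_and]
    field_simp
    linear_combination h3
  have c2 : #{a ∈ coneSection (X, Y, T, S) | ¬ a.2.2.1 = 0} ≤ #(circlePoints F (-m))ᶜ := by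
    have rel : ∀ x y t s : F, (x, y, t, s) ∈ coneSection (X, Y, T, S) → t ≠ 0 →
        (T / t * x - X) ^ 2 + (T / t * y - Y) ^ 2 + m = m * (T / t) := by
      intro x y t s ha ht
      obtain ⟨h1, h3⟩ := equations_of_mem_coneSection ha
      field_simp
      simp only [hmdef] at *
      linear_combination T * t * h3 - T ^ 2 * h1
    refine card_le_card_of_injOn
      (fun a => (T / a.2.2.1 * a.1 - X, T / a.2.2.1 * a.2.1 - Y)) ?_ ?_
    · rintro ⟨x, y, t, s⟩ ha
      simp only [coe_filter, Set.mem_ofPred_eq] at ha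
      have := rel x y t s ha.1 ha.2
      simp only [coe_compl, Set.mem_compl_iff, SetLike.mem_coe, mem_circlePoints]
      intro h0
      have : m * (T / t) = 0 := by linear_combination h0 - this
      exact mul_ne_zero hm (div_ne_zero hT ha.2) this
    · rintro ⟨x, y, t, s⟩ ha ⟨x', y', t', s'⟩ hb hab
      simp only [coe_filter, Set.mem_ofPred_eq, Prod.mk.injEq] at ha hb hab
      have r1 := rel x y t s ha.1 ha.2
      have r2 := rel x' y' t' s' hb.1 hb.2
      rw [hab.1, hab.2] at r1
      have e : T / t = T / t' := mul_left_cancel₀ hm (r1.symm.trans r2)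
      have et : t = t' := by
        have ht := ha.2
        have ht' := hb.2
        field_simp at e
        exact e.symm
      subst et
      have hTt : T / t ≠ 0 := div_ne_zero hT ha.2
      have ex : x = x' := mul_left_cancel₀ hTt (sub_left_inj.1 hab.1)
      have ey : y = y' := mul_left_cancel₀ hTt (sub_left_inj.1 hab.2)
      subst ex ey
      have := (equations_of_mem_coneSection ha.1).1
      have := (equations_of_mem_coneSection hb.1).1
      have es : s = s' := mul_left_cancel₀ ha.2 (by simp_all)
      rw [es]
  rw [card_compl, card_circlePoints h hchar (neg_ne_zero.2 hm), Fintype.card_prod] at c2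
  have hq : 1 < Fintype.card F := Fintype.one_lt_card
  obtain ⟨r, hr⟩ : ∃ r, Fintype.card F = r + 2 := ⟨_, (Nat.sub_add_cancel hq).symm⟩
  rw [hr] at c2 ⊢
  have e : (r + 2) * (r + 2) - (r + 2 + 1) = r * r + 3 * r + 1 := by
    rw [Nat.sub_eq_iff_eq_add (by nlinarith)]; ring
  rw [e] at c2
  calc _ ≤ 1 + (r * r + 3 * r + 1) := add_le_add c1 c2
    _ = (r + 2) * (r + 1) := by ring

lemma card_coneSection_swap_le (X Y T S : F) :
    #(coneSection (X, Y, T, S)) ≤ #(coneSection (X, Y, S, T)) := by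
  refine card_le_card_of_injOn (fun a => (a.1, a.2.1, a.2.2.2, a.2.2.1)) ?_ ?_
  · rintro ⟨x, y, t, s⟩ ha
    simp only [coneSection, SetLike.mem_coe, mem_filter, mem_puncturedCone, Prod.mk_sub_mk,
      ne_eq, Prod.mk_eq_zero] at ha ⊢
    rw [mul_comm s t, mul_comm (S - s)]
    tauto
  · rintro ⟨x, y, t, s⟩ - ⟨x', y', t', s'⟩ - hab
    simp only [Prod.mk.injEq] at *
    tauto

/-- The count for `η` in the anisotropic plane `τ = σ = 0`. -/
lemma card_coneSection_plane_le (h : ¬ IsSquare (-1 : F)) (h2 : (2 : F) ≠ 0)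
    {X Y : F} (hm : X ^ 2 + Y ^ 2 ≠ 0) :
    #(coneSection (X, Y, 0, 0)) ≤ Fintype.card F * (Fintype.card F - 1) := by
  have ht : ∀ x y t s : F, (x, y, t, s) ∈ coneSection (X, Y, 0, 0) → t ≠ 0 := by
    rintro x y t s ha rfl
    obtain ⟨h1, h3⟩ := equations_of_mem_coneSection ha
    obtain ⟨rfl, rfl⟩ := eq_zero_of_sq_add_sq_eq_zero h
      (by linear_combination -h1 : x ^ 2 + y ^ 2 = 0)
    exact hm (by linear_combination h3)
  have hcard : #((univ : Finset F) ×ˢ (univ.erase 0 : Finset F)) =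
      Fintype.card F * (Fintype.card F - 1) := by
    rw [card_product, card_erase_of_mem (mem_univ _), card_univ]
  rw [← hcard]
  refine card_le_card_of_injOn (fun a => (X * a.2.1 - Y * a.1, a.2.2.1)) ?_ ?_
  · rintro ⟨x, y, t, s⟩ ha
    simpa using ht x y t s ha
  · rintro ⟨x, y, t, s⟩ ha ⟨x', y', t', s'⟩ hb hab
    simp only [Prod.mk.injEq] at hab
    obtain ⟨hxy, rfl⟩ := hab
    have ht := ht x y t s ha
    obtain ⟨h1, h3⟩ := equations_of_mem_coneSection ha
    obtain ⟨h4, h5⟩ := equations_of_mem_coneSection hb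
    have e : X * x + Y * y = X * x' + Y * y' :=
      mul_left_cancel₀ h2 (by linear_combination h5 - h3)
    have ex : x = x' := mul_left_cancel₀ hm (by linear_combination X * e - Y * hxy)
    have ey : y = y' := mul_left_cancel₀ hm (by linear_combination Y * e + X * hxy)
    subst ex ey
    rw [mul_left_cancel₀ ht (h1.trans h4.symm)]

lemma card_coneSection_le (h : ¬ IsSquare (-1 : F)) (hchar : ringChar F ≠ 2)
    {η : F × F × F × F} (h0 : η ≠ 0) (hη : η ∉ puncturedCone F) :
    #(coneSection η) ≤ Fintype.card F * (Fintype.card F - 1) := by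
  obtain ⟨X, Y, T, S⟩ := η
  have hm : T * S - X ^ 2 - Y ^ 2 ≠ 0 := by
    intro e
    exact hη (mem_puncturedCone.2 ⟨by linear_combination e, h0⟩)
  by_cases hT : T = 0
  · by_cases hS : S = 0
    · subst hT hS
      exact card_coneSection_plane_le h (Ring.two_ne_zero hchar)
        fun e => hm (by linear_combination -e)
    · refine (card_coneSection_swap_le X Y T S).trans
        (card_coneSection_le_of_ne_zero h hchar ?_ hS)
      rwa [mul_comm]
  · exact card_coneSection_le_of_ne_zero h hchar hm hT

lemma coneSection_zero : coneSection (0 : F × F × F × F) = puncturedCone F := by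
  refine filter_true_of_mem fun a ha => ?_
  rw [zero_sub]
  exact neg_mem_puncturedCone ha

/-- Pairs in the cone summing to `η`. -/
def conePairs (η : F × F × F × F) : Finset ((F × F × F × F) × (F × F × F × F)) :=
  (puncturedCone F ×ˢ puncturedCone F).filter fun y => y.1 + y.2 = η

lemma sum_conePairs {M : Type*} [AddCommMonoid M] (η : F × F × F × F)
    (w : (F × F × F × F) × (F × F × F × F) → M) :
    ∑ y ∈ conePairs η, w y = ∑ a ∈ coneSection η, w (a, η - a) := by
  refine sum_nbij' (fun y => y.1) (fun a => (a, η - a)) ?_ ?_ ?_ ?_ ?_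
  · rintro ⟨a, b⟩ hy
    simp only [conePairs, coneSection, mem_filter, mem_product] at *
    obtain ⟨⟨ha, hb⟩, rfl⟩ := hy
    exact ⟨ha, by simpa using hb⟩
  · intro a ha
    simp only [conePairs, coneSection, mem_filter, mem_product] at *
    exact ⟨ha, by simp⟩
  · rintro ⟨a, b⟩ hy
    obtain ⟨-, rfl⟩ := mem_filter.1 hy
    simp
  · intro a _; rfl
  · rintro ⟨a, b⟩ hy
    obtain ⟨-, rfl⟩ := mem_filter.1 hy
    simp

lemma card_conePairs (η : F × F × F × F) : #(conePairs η) = #(coneSection η) := by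
  simp only [card_eq_sum_ones, sum_conePairs]

lemma sum_puncturedCone_smul (t : Fˣ) (w : F × F × F × F → ℝ) :
    ∑ a ∈ puncturedCone F, w (t • a) = ∑ a ∈ puncturedCone F, w a := by
  refine sum_nbij' (fun a => t • a) (fun a => t⁻¹ • a) ?_ ?_ ?_ ?_ ?_
  · exact fun a ha => smul_mem_puncturedCone t ha
  · exact fun a ha => smul_mem_puncturedCone t⁻¹ ha
  all_goals intro a _; simp

lemma sum_puncturedCone_neg (w : F × F × F × F → ℝ) :
    ∑ a ∈ puncturedCone F, w (-a) = ∑ a ∈ puncturedCone F, w a := by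
  simpa using sum_puncturedCone_smul (-1 : Fˣ) w

lemma add_smul_mem_insert (t : Fˣ) {a : F × F × F × F} (ha : a ∈ puncturedCone F) :
    a + t • a ∈ insert 0 (puncturedCone F) := by
  have e : a + t • a = (1 + (t : F)) • a := by rw [add_smul, one_smul, Units.smul_def]
  rw [e, mem_insert]
  by_cases h0 : 1 + (t : F) = 0
  · left; rw [h0, zero_smul]
  · right; exact smul_mem_puncturedCone (Units.mk0 _ h0) ha

/-- The mass carried by pairs of proportional points is bounded below, by Cauchy-Schwarz over
the generators of the cone. -/
lemma sq_sum_le_sum_isotropic_pairs (u : F × F × F × F → ℝ) (hu : ∀ a, 0 ≤ u a) :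
    ((Fintype.card F : ℝ) - 1) * (∑ a ∈ puncturedCone F, u a) ^ 2 ≤
      #(puncturedCone F) *
        ∑ η ∈ insert 0 (puncturedCone F), ∑ y ∈ conePairs η, u y.1 * u y.2 := by
  set T : F × F × F × F → ℝ := fun a => ∑ t : Fˣ, u (t • a) with hT
  have hr : (Fintype.card Fˣ : ℝ) = (Fintype.card F : ℝ) - 1 := by
    rw [Fintype.card_units, Nat.cast_sub Fintype.card_pos, Nat.cast_one]
  have hr0 : 0 < (Fintype.card Fˣ : ℝ) := by exact_mod_cast Fintype.card_pos
  have hTinv : ∀ (s : Fˣ) a, T (s • a) = T a := by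
    intro s a
    simp only [hT, smul_smul]
    exact Fintype.sum_equiv (Equiv.mulRight s) _ _ fun t => rfl
  have sumT : ∑ a ∈ puncturedCone F, T a = Fintype.card Fˣ * ∑ a ∈ puncturedCone F, u a := by
    simp only [hT]
    rw [sum_comm]
    simp [sum_puncturedCone_smul]
  have sumT2 : ∑ a ∈ puncturedCone F, T a ^ 2 =
      Fintype.card Fˣ * ∑ a ∈ puncturedCone F, u a * T a := by
    calc ∑ a ∈ puncturedCone F, T a ^ 2
        = ∑ a ∈ puncturedCone F, ∑ s : Fˣ, u (s • a) * T (s • a) := by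
          refine sum_congr rfl fun a _ => ?_
          simp only [hTinv]
          rw [← sum_mul, sq]
      _ = _ := by
          rw [sum_comm]
          simp [sum_puncturedCone_smul _ fun a => u a * T a]
  have lower : ∑ a ∈ puncturedCone F, u a * T a ≤
      ∑ η ∈ insert 0 (puncturedCone F), ∑ y ∈ conePairs η, u y.1 * u y.2 := by
    simp only [conePairs]
    rw [sum_fiberwise_eq_sum_filter]
    simp only [hT, mul_sum]
    rw [← sum_product' (f := fun a (t : Fˣ) => u a * u (t • a)),
      ← sum_image (f := fun y : (F × F × F × F) × (F × F × F × F) => u y.1 * u y.2)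
        (g := fun x : (F × F × F × F) × Fˣ => (x.1, x.2 • x.1))]
    · refine sum_le_sum_of_subset_of_nonneg ?_ fun y _ _ => mul_nonneg (hu _) (hu _)
      intro y hy
      obtain ⟨⟨a, t⟩, hx, rfl⟩ := mem_image.1 hy
      have ha : a ∈ puncturedCone F := (mem_product.1 hx).1
      exact mem_filter.2 ⟨mem_product.2 ⟨ha, smul_mem_puncturedCone t ha⟩,
        add_smul_mem_insert t ha⟩
    · rintro ⟨a, t⟩ hx ⟨b, s⟩ - hab
      simp only [Prod.mk.injEq] at hab ⊢
      obtain ⟨rfl, hab⟩ := hab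
      have ha : a ∈ puncturedCone F := (mem_product.1 hx).1
      refine ⟨rfl, Units.ext (smul_left_injective F (mem_puncturedCone.1 ha).2 ?_)⟩
      simpa [Units.smul_def] using hab
  have cs := sq_sum_le_card_mul_sum_sq (s := puncturedCone F) (f := T)
  rw [sumT, sumT2] at cs
  have cs' : (Fintype.card Fˣ : ℝ) * (∑ a ∈ puncturedCone F, u a) ^ 2 ≤
      #(puncturedCone F) * ∑ a ∈ puncturedCone F, u a * T a := by
    refine le_of_mul_le_mul_left ?_ hr0
    linarith
  rw [← hr]
  exact cs'.trans (by gcongr)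

/-- The part of the extension inequality which keeps track of `g(a) g(-a)`. -/
lemma sum_sq_conePairs_le (h : ¬ IsSquare (-1 : F)) (hchar : ringChar F ≠ 2)
    (g : F × F × F × F → ℝ) :
    ∑ η, (∑ y ∈ conePairs η, g y.1 * g y.2) ^ 2 ≤
      (∑ a ∈ puncturedCone F, g a * g (-a)) ^ 2
      - ((Fintype.card F : ℝ) - 2) * ∑ a ∈ puncturedCone F, (g a * g (-a)) ^ 2
      + (Fintype.card F : ℝ) * (Fintype.card F - 1) * (∑ a ∈ puncturedCone F, g a ^ 2) ^ 2
      - ((Fintype.card F : ℝ) ^ 2 - 2 * Fintype.card F + 2) *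
        ∑ η ∈ insert 0 (puncturedCone F), ∑ y ∈ conePairs η, g y.1 ^ 2 * g y.2 ^ 2 := by
  set q : ℝ := (Fintype.card F : ℝ) with hq
  set D : F × F × F × F → ℝ := fun η => ∑ y ∈ conePairs η, g y.1 ^ 2 * g y.2 ^ 2 with hD
  have hq2 : 1 < Fintype.card F := Fintype.one_lt_card
  have hDnn : ∀ η, 0 ≤ D η := fun η => sum_nonneg fun y _ => by positivity
  have cs : ∀ η, (∑ y ∈ conePairs η, g y.1 * g y.2) ^ 2 ≤ #(coneSection η) * D η := by
    intro η
    rw [← card_conePairs]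
    simpa only [mul_pow] using
      sq_sum_le_card_mul_sum_sq (s := conePairs η) (f := fun y => g y.1 * g y.2)
  have h0 : (0 : F × F × F × F) ∉ puncturedCone F := by simp [mem_puncturedCone]
  have total : ∑ η, D η = (∑ a ∈ puncturedCone F, g a ^ 2) ^ 2 := by
    simp only [hD, conePairs]
    rw [sum_fiberwise, sum_product, sq, sum_mul_sum]
  have zero1 : ∑ y ∈ conePairs (0 : F × F × F × F), g y.1 * g y.2 =
      ∑ a ∈ puncturedCone F, g a * g (-a) := by
    simp [sum_conePairs, coneSection_zero]
  have zero2 : D 0 = ∑ a ∈ puncturedCone F, (g a * g (-a)) ^ 2 := by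
    simp [hD, sum_conePairs, coneSection_zero, mul_pow]
  have onCone : ∑ η ∈ puncturedCone F, (∑ y ∈ conePairs η, g y.1 * g y.2) ^ 2 ≤
      (q - 2) * ∑ η ∈ puncturedCone F, D η := by
    rw [mul_sum]
    refine sum_le_sum fun η hη => (cs η).trans (mul_le_mul_of_nonneg_right ?_ (hDnn η))
    rw [hq, ← Nat.cast_ofNat, ← Nat.cast_sub hq2]
    exact_mod_cast card_coneSection_le_of_mem h hη
  have offCone : ∑ η ∈ (insert 0 (puncturedCone F))ᶜ, (∑ y ∈ conePairs η, g y.1 * g y.2) ^ 2 ≤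
      q * (q - 1) * ∑ η ∈ (insert 0 (puncturedCone F))ᶜ, D η := by
    rw [mul_sum]
    refine sum_le_sum fun η hη => (cs η).trans (mul_le_mul_of_nonneg_right ?_ (hDnn η))
    rw [hq, ← Nat.cast_one, ← Nat.cast_sub hq2.le]
    simp only [mem_compl, mem_insert, not_or] at hη
    exact_mod_cast card_coneSection_le h hchar hη.1 hη.2
  have split : ∀ w : F × F × F × F → ℝ, ∑ η, w η =
      w 0 + ∑ η ∈ puncturedCone F, w η + ∑ η ∈ (insert 0 (puncturedCone F))ᶜ, w η := by
    intro w
    rw [← sum_insert h0, sum_add_sum_compl]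
  rw [split] at total ⊢
  rw [sum_insert h0, zero1, ← zero2]
  rw [← total]
  linarith

/-- A nonnegative function reaching the sharp constant is constant on the cone. -/
lemma sq_eq_of_le_sum_sq_conePairs (h : Fintype.card F % 4 = 3)
    (g : F × F × F × F → ℝ) (hg : ∀ a, 0 ≤ g a)
    (hle : ((Fintype.card F : ℝ) ^ 5 - 2 * Fintype.card F ^ 4 + 2 * Fintype.card F ^ 3
        - 3 * Fintype.card F + 3) / (((Fintype.card F : ℝ) - 1) * (Fintype.card F ^ 2 + 1)) *
        (∑ a ∈ puncturedCone F, g a ^ 2) ^ 2 ≤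
      ∑ η, (∑ y ∈ conePairs η, g y.1 * g y.2) ^ 2)
    {a : F × F × F × F} (ha : a ∈ puncturedCone F) :
    g a ^ 2 = (∑ b ∈ puncturedCone F, g b ^ 2) / #(puncturedCone F) := by
  have hsq : ¬ IsSquare (-1 : F) := by
    rw [FiniteField.isSquare_neg_one_iff]; simpa using h
  have hchar : ringChar F ≠ 2 := by
    intro e
    have := FiniteField.even_card_iff_char_two.1 e
    omega
  have hq3 : (3 : ℝ) ≤ Fintype.card F := by
    have : 3 ≤ Fintype.card F := by omega
    exact_mod_cast this
  have up := sum_sq_conePairs_le hsq hchar g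
  have low := sq_sum_le_sum_isotropic_pairs (fun a => g a ^ 2) fun a => sq_nonneg _
  have hN : (#(puncturedCone F) : ℝ) =
      ((Fintype.card F : ℝ) - 1) * ((Fintype.card F : ℝ) ^ 2 + 1) := by
    rw [card_puncturedCone hsq, Nat.cast_mul, Nat.cast_sub Fintype.card_pos]
    push_cast; rfl
  have cs := sq_sum_le_card_mul_sum_sq (s := puncturedCone F) (f := fun a => g a * g (-a))
  have hX0 : 0 ≤ ∑ a ∈ puncturedCone F, g a * g (-a) :=
    sum_nonneg fun a _ => mul_nonneg (hg _) (hg _)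
  have diff : ∑ a ∈ puncturedCone F, (g a - g (-a)) ^ 2 =
      2 * (∑ a ∈ puncturedCone F, g a ^ 2) - 2 * ∑ a ∈ puncturedCone F, g a * g (-a) := by
    have e := sum_puncturedCone_neg fun a => g a ^ 2
    calc _ = ∑ a ∈ puncturedCone F, (g a ^ 2 + g (-a) ^ 2 - 2 * (g a * g (-a))) :=
          sum_congr rfl fun a _ => by ring
      _ = _ := by rw [sum_sub_distrib, sum_add_distrib, e, ← mul_sum]; ring
  have var : ∑ a ∈ puncturedCone F,
        (g a * g (-a) - (∑ b ∈ puncturedCone F, g b ^ 2) / #(puncturedCone F)) ^ 2 =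
      (∑ a ∈ puncturedCone F, (g a * g (-a)) ^ 2)
      - 2 * ((∑ b ∈ puncturedCone F, g b ^ 2) / #(puncturedCone F)) *
        ∑ a ∈ puncturedCone F, g a * g (-a)
      + #(puncturedCone F) * ((∑ b ∈ puncturedCone F, g b ^ 2) / #(puncturedCone F)) ^ 2 := by
    simp only [sub_sq, sum_add_distrib, sum_sub_distrib, sum_const, nsmul_eq_mul]
    rw [mul_sum]
    congr 2
    exact sum_congr rfl fun a _ => by ring
  have hN0 : (0 : ℝ) < #(puncturedCone F) := by exact_mod_cast card_pos.2 ⟨a, ha⟩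
  have hSX : 0 ≤ ∑ a ∈ puncturedCone F, (g a - g (-a)) ^ 2 := sum_nonneg fun a _ => sq_nonneg _
  have hdiff0 := sum_eq_zero_iff_of_nonneg
    (s := puncturedCone F) (f := fun a => (g a - g (-a)) ^ 2) fun a _ => sq_nonneg _
  have hvar0 := sum_eq_zero_iff_of_nonneg (s := puncturedCone F)
    (f := fun a => (g a * g (-a) - (∑ b ∈ puncturedCone F, g b ^ 2) / #(puncturedCone F)) ^ 2)
    fun a _ => sq_nonneg _
  have hvarnn : 0 ≤ ∑ a ∈ puncturedCone F,
      (g a * g (-a) - (∑ b ∈ puncturedCone F, g b ^ 2) / #(puncturedCone F)) ^ 2 :=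
    sum_nonneg fun a _ => sq_nonneg _
  rw [diff] at hdiff0 hSX
  rw [var] at hvar0 hvarnn
  have hle' := hle.trans up
  rw [← hN, div_mul_eq_mul_div, div_le_iff₀ hN0] at hle'
  generalize (∑ η ∈ insert 0 (puncturedCone F), ∑ y ∈ conePairs η, g y.1 ^ 2 * g y.2 ^ 2) = P at *
  generalize (∑ a ∈ puncturedCone F, (g a * g (-a)) ^ 2) = Z at *
  generalize (∑ a ∈ puncturedCone F, g a * g (-a)) = X at *
  generalize (∑ b ∈ puncturedCone F, g b ^ 2) = S at *
  generalize (#(puncturedCone F) : ℝ) = N at *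
  generalize (Fintype.card F : ℝ) = q at *
  have key : (N - (q - 2)) * S ^ 2 ≤ N * (X ^ 2 - (q - 2) * Z) := by
    have hk : 0 ≤ q ^ 2 - 2 * q + 2 := by nlinarith
    have := mul_le_mul_of_nonneg_left low hk
    subst hN
    nlinarith
  have hNq : 0 < N - (q - 2) := by rw [hN]; nlinarith [sq_nonneg q]
  have hXS : X = S := by
    refine le_antisymm (by linarith) ?_
    have : S ^ 2 ≤ X ^ 2 := by
      refine le_of_mul_le_mul_left (key.trans ?_) hNq
      nlinarith [mul_le_mul_of_nonneg_left cs (by linarith : 0 ≤ q - 2)]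
    exact le_of_sq_le_sq this hX0
  subst hXS
  have hZ : N * Z ≤ X ^ 2 := by
    refine le_of_mul_le_mul_left ?_ (by linarith : 0 < q - 2)
    linarith
  have hs := hdiff0.1 (by ring) a ha
  have hv := hvar0.1 (by
    refine le_antisymm ?_ hvarnn
    have : Z ≤ X ^ 2 / N := by rw [le_div_iff₀ hN0]; linarith
    have e : Z - 2 * (X / N) * X + N * (X / N) ^ 2 = Z - X ^ 2 / N := by field_simp; ring
    rw [e]; linarith) a ha
  have hs' : g a = g (-a) := by simpa [sub_eq_zero] using hs
  have hv' : g a * g (-a) = X / N := by simpa [sub_eq_zero] using hv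
  rw [← hv', ← hs', sq]

end Geometry



/-- Any maximizer of the sharp L²→L⁴ extension inequality from the punctured cone Γ³ ⊂ F⁴
(q ≡ 3 (mod 4)) has constant modulus on Γ³. -/
theorem cone_maximizers_constant_modulus
    (p n q : ℕ) (hp : p.Prime) (hp2 : p ≠ 2) (hn : 0 < n) (hq : q = p ^ n)
    (hq4 : q % 4 = 3)
    (F : Type) [Field F] [Fintype F] [DecidableEq F] (hF : Fintype.card F = q)
    (f : F × F × F × F → ℂ)
    (heq :
      (∑ η : F × F × F × F,
        ‖∑ y ∈ ((univ.filter (fun v : F × F × F × F =>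
              v.2.2.1 * v.2.2.2 = v.1 ^ 2 + v.2.1 ^ 2 ∧ v ≠ 0)) ×ˢ
            (univ.filter (fun v : F × F × F × F =>
              v.2.2.1 * v.2.2.2 = v.1 ^ 2 + v.2.1 ^ 2 ∧ v ≠ 0))).filter
            (fun y => y.1 + y.2 = η), f y.1 * f y.2‖ ^ 2)
      = (((q : ℝ) ^ 5 - 2 * q ^ 4 + 2 * q ^ 3 - 3 * q + 3) / (((q : ℝ) - 1) * (q ^ 2 + 1))) *
        (∑ η ∈ univ.filter (fun v : F × F × F × F =>
            v.2.2.1 * v.2.2.2 = v.1 ^ 2 + v.2.1 ^ 2 ∧ v ≠ 0), ‖f η‖ ^ 2) ^ 2) :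
    ∃ c : ℝ, ∀ v : F × F × F × F,
      (v.2.2.1 * v.2.2.2 = v.1 ^ 2 + v.2.1 ^ 2 ∧ v ≠ 0) → ‖f v‖ = c := by
  subst hF
  have hle := heq.symm.le.trans (sum_le_sum fun η _ => show _ ≤
      (∑ y ∈ conePairs η, ‖f y.1‖ * ‖f y.2‖) ^ 2 by
    refine pow_le_pow_left₀ (norm_nonneg _) ((norm_sum_le _ _).trans_eq ?_) 2
    exact sum_congr rfl fun y _ => norm_mul _ _)
  refine ⟨√((∑ b ∈ puncturedCone F, ‖f b‖ ^ 2) / #(puncturedCone F)), fun v hv => ?_⟩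
  rw [← sq_eq_of_le_sum_sq_conePairs hq4 (fun a => ‖f a‖) (fun a => norm_nonneg _) hle
    (mem_puncturedCone.2 hv), Real.sqrt_sq (norm_nonneg _)]
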